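/- Let c_1,...,c_l be real numbers (l >= 2) with associated 2x2 matrix [[alpha, beta],[gamma, delta]] = [[0,-1],[1,0]] * [[c_1,-1],[1,0]] * ... * [[c_l,-1],[1,0]]. Then the signature of the tridiagonal matrix Lambda(c_1,...,c_l) equals the signature of Lambda(c_1,...,c_{l-1}) minus sgn(gamma)*sgn(delta). -/

import Mathlib

open scoped Classical

/-- The `l × l` symmetric tridiagonal matrix with diagonal entries `c 0, ..., c (l-1)`
and sub/super-diagonal entries `1`. -/
def tridiag {l : ℕ} (c : Fin l → ℝ) : Matrix (Fin l) (Fin l) ℝ :=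
  Matrix.of fun i j =>
    if i = j then c i else if (i : ℕ) + 1 = (j : ℕ) ∨ (j : ℕ) + 1 = (i : ℕ) then 1 else 0

/-- The associated `2 × 2` matrix
`A(c_1,...,c_l) = [[0,-1],[1,0]] * [[c_1,-1],[1,0]] * ⋯ * [[c_l,-1],[1,0]]`. -/
def assocMat {l : ℕ} (c : Fin l → ℝ) : Matrix (Fin 2) (Fin 2) ℝ :=
  !![0, -1; 1, 0] * (List.ofFn fun i => !![c i, -1; 1, 0]).prod

/-- The signature of a real symmetric matrix: the number of positive eigenvalues
minus the number of negative eigenvalues. -/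
noncomputable def signature {n : Type*} [Fintype n] [DecidableEq n]
    (M : Matrix n n ℝ) : ℤ :=
  if hM : M.IsHermitian then
    ((Finset.univ.filter fun i => 0 < hM.eigenvalues i).card : ℤ)
      - ((Finset.univ.filter fun i => hM.eigenvalues i < 0).card : ℤ)
  else 0

open Matrix QuadraticMap in
/-- A real symmetric matrix defines a quadratic form equivalent to the sum of squares weighted by
its eigenvalues. -/
lemma Matrix.IsHermitian.equivalent_weightedSumSquares_eigenvalues {n : Type*} [Fintype n]
    [DecidableEq n] {A : Matrix n n ℝ} (hA : A.IsHermitian) :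
    Equivalent A.toQuadraticForm' (weightedSumSquares ℝ hA.eigenvalues) := by
  have hU : (hA.eigenvectorUnitary : Matrix n n ℝ) * star (hA.eigenvectorUnitary : Matrix n n ℝ)
      = 1 := Unitary.coe_mul_star_self _
  have hU' : star (hA.eigenvectorUnitary : Matrix n n ℝ) * (hA.eigenvectorUnitary : Matrix n n ℝ)
      = 1 := Unitary.coe_star_mul_self _
  have hs := hA.spectral_theorem
  rw [Unitary.conjStarAlgAut_apply] at hs
  refine ⟨⟨Matrix.toLin'OfInv hU hU', fun x => ?_⟩⟩
  generalize (hA.eigenvectorUnitary : Matrix n n ℝ) = U at *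
  have key : A.toQuadraticForm' x = x ⬝ᵥ A *ᵥ x := by
    simp [Matrix.toQuadraticForm', Matrix.toLinearMap₂'_apply']
  rw [key]
  conv_rhs => rw [hs]
  rw [← mulVec_mulVec, ← mulVec_mulVec, dotProduct_mulVec, ← mulVec_transpose]
  simp [weightedSumSquares_apply, dotProduct, mulVec_diagonal, star_eq_conjTranspose]
  exact Finset.sum_congr rfl fun i _ => by ring

/-- Restricting a quadratic form along an injective linear map does not increase `sigPos`. -/
lemma QuadraticMap.sigPos_comp_le {M M' : Type*} [AddCommGroup M] [Module ℝ M]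
    [FiniteDimensional ℝ M] [AddCommGroup M'] [Module ℝ M'] [FiniteDimensional ℝ M']
    (Q : QuadraticForm ℝ M) (f : M' →ₗ[ℝ] M) (hf : Function.Injective f) :
    sigPos (Q.comp f) ≤ sigPos Q := by
  obtain ⟨V, hV, hpos⟩ := exists_finrank_eq_sigPos_and_posDef (Q.comp f)
  rw [← hV, (V.equivMapOfInjective f hf).finrank_eq]
  refine le_sigPos_of_posDef Q ?_
  rintro ⟨_, x, hx, rfl⟩ hne
  exact hpos ⟨x, hx⟩ fun h => hne (Subtype.ext (by simpa using congrArg (fun y : V => f y) h))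

/-- Restricting a quadratic form along an injective linear map decreases `sigPos` by at most
the codimension. -/
lemma QuadraticMap.sigPos_add_finrank_le {M M' : Type*} [AddCommGroup M] [Module ℝ M]
    [FiniteDimensional ℝ M] [AddCommGroup M'] [Module ℝ M'] [FiniteDimensional ℝ M']
    (Q : QuadraticForm ℝ M) (f : M' →ₗ[ℝ] M) (hf : Function.Injective f) :
    sigPos Q + Module.finrank ℝ M' ≤ sigPos (Q.comp f) + Module.finrank ℝ M := by
  obtain ⟨V, hV, hpos⟩ := exists_finrank_eq_sigPos_and_posDef Q
  have hle : Module.finrank ℝ (V.comap f) ≤ sigPos (Q.comp f) := by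
    refine le_sigPos_of_posDef (Q.comp f) ?_
    rintro ⟨x, hx⟩ hne
    exact hpos ⟨f x, hx⟩ fun h => hne (Subtype.ext (hf (by simpa using h)))
  have hmap : Module.finrank ℝ (V.comap f) = Module.finrank ℝ (V ⊓ f.range : Submodule ℝ M) := by
    rw [((V.comap f).equivMapOfInjective f hf).finrank_eq, Submodule.map_comap_eq, inf_comm]
  have hsum := Submodule.finrank_sup_add_finrank_inf_eq V f.range
  have hsup := (V ⊔ f.range).finrank_le
  have hrange := LinearMap.finrank_range_of_inj hf
  omega

lemma Matrix.IsHermitian.sigPos_eq_card {n : Type*} [Fintype n] [DecidableEq n]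
    {A : Matrix n n ℝ} (hA : A.IsHermitian) :
    sigPos A.toQuadraticForm' = (Finset.univ.filter fun i => 0 < hA.eigenvalues i).card := by
  rw [QuadraticForm.sigPos_of_equiv_weightedSumSquares
    hA.equivalent_weightedSumSquares_eigenvalues, Set.ncard_eq_toFinset_card']
  simp

lemma Matrix.IsHermitian.sigNeg_eq_card {n : Type*} [Fintype n] [DecidableEq n]
    {A : Matrix n n ℝ} (hA : A.IsHermitian) :
    sigNeg A.toQuadraticForm' = (Finset.univ.filter fun i => hA.eigenvalues i < 0).card := by
  rw [QuadraticForm.sigNeg_of_equiv_weightedSumSquares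
    hA.equivalent_weightedSumSquares_eigenvalues, Set.ncard_eq_toFinset_card']
  simp

lemma Matrix.IsHermitian.signature_eq {n : Type*} [Fintype n] [DecidableEq n]
    {A : Matrix n n ℝ} (hA : A.IsHermitian) :
    signature A = (sigPos A.toQuadraticForm' : ℤ) - sigNeg A.toQuadraticForm' := by
  rw [hA.sigPos_eq_card, hA.sigNeg_eq_card, signature, dif_pos hA]

lemma Matrix.IsHermitian.sigPos_add_sigNeg_add_card_eigenvalues_eq_zero {n : Type*} [Fintype n]
    [DecidableEq n] {A : Matrix n n ℝ} (hA : A.IsHermitian) :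
    sigPos A.toQuadraticForm' + sigNeg A.toQuadraticForm'
      + (Finset.univ.filter fun i => hA.eigenvalues i = 0).card = Fintype.card n := by
  rw [hA.sigPos_eq_card, hA.sigNeg_eq_card, ← Finset.card_union_of_disjoint,
    ← Finset.card_union_of_disjoint, ← Finset.card_univ]
  · congr 1
    ext i
    simpa [or_assoc] using by grind
  · rw [Finset.disjoint_left]; simp; grind
  · rw [Finset.disjoint_left]; simp; grind

lemma Matrix.IsHermitian.sigPos_add_sigNeg_of_det_ne_zero {n : Type*} [Fintype n]
    [DecidableEq n] {A : Matrix n n ℝ} (hA : A.IsHermitian) (h : A.det ≠ 0) :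
    sigPos A.toQuadraticForm' + sigNeg A.toQuadraticForm' = Fintype.card n := by
  rw [← hA.sigPos_add_sigNeg_add_card_eigenvalues_eq_zero, left_eq_add, Finset.card_eq_zero]
  simpa [hA.det_eq_prod_eigenvalues, Finset.prod_eq_zero_iff, Finset.filter_eq_empty_iff] using h

lemma Matrix.IsHermitian.sigPos_add_sigNeg_lt_of_det_eq_zero {n : Type*} [Fintype n]
    [DecidableEq n] {A : Matrix n n ℝ} (hA : A.IsHermitian) (h : A.det = 0) :
    sigPos A.toQuadraticForm' + sigNeg A.toQuadraticForm' < Fintype.card n := by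
  rw [← hA.sigPos_add_sigNeg_add_card_eigenvalues_eq_zero, lt_add_iff_pos_right, Finset.card_pos]
  simpa [hA.det_eq_prod_eigenvalues, Finset.prod_eq_zero_iff, Finset.filter_nonempty_iff] using h

lemma Real.sign_mul (x y : ℝ) : Real.sign (x * y) = Real.sign x * Real.sign y := by
  rcases lt_trichotomy x 0 with hx | rfl | hx <;> rcases lt_trichotomy y 0 with hy | rfl | hy
  all_goals simp [sign_of_neg, sign_of_pos, mul_pos_of_neg_of_neg, mul_neg_of_neg_of_pos,
    mul_neg_of_pos_of_neg, *]

lemma Matrix.IsHermitian.sign_det {n : Type*} [Fintype n] [DecidableEq n]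
    {A : Matrix n n ℝ} (hA : A.IsHermitian) (h : A.det ≠ 0) :
    Real.sign A.det = (-1) ^ sigNeg A.toQuadraticForm' := by
  rw [hA.det_eq_prod_eigenvalues] at h ⊢
  rw [hA.sigNeg_eq_card, Finset.card_filter, ← Finset.prod_pow_eq_pow_sum]
  generalize hA.eigenvalues = w at *
  have key (s : Finset n) : Real.sign (∏ i ∈ s, w i) = ∏ i ∈ s, Real.sign (w i) := by
    induction s using Finset.induction_on with
    | empty => simp
    | insert i s hi ih => rw [Finset.prod_insert hi, Finset.prod_insert hi, Real.sign_mul, ih]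
  simp only [RCLike.ofReal_real_eq_id, id] at h ⊢
  rw [key]
  refine Finset.prod_congr rfl fun i _ => ?_
  rcases lt_or_gt_of_ne (Finset.prod_ne_zero_iff.mp h i (Finset.mem_univ i)) with hi | hi
  · simp [Real.sign_of_neg hi, hi]
  · simp [Real.sign_of_pos hi, hi.not_gt]

/-- The signature of a real symmetric matrix exceeds the signature of its leading principal
submatrix of codimension one by the product of the signs of the two determinants, provided these
do not both vanish. -/
theorem Matrix.IsHermitian.signature_eq_signature_submatrix_castSucc {n : ℕ}
    {A : Matrix (Fin (n + 1)) (Fin (n + 1)) ℝ} (hA : A.IsHermitian)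
    (h : A.det ≠ 0 ∨ (A.submatrix Fin.castSucc Fin.castSucc).det ≠ 0) :
    (signature A : ℝ) = signature (A.submatrix Fin.castSucc Fin.castSucc)
      + Real.sign A.det * Real.sign (A.submatrix Fin.castSucc Fin.castSucc).det := by
  set B := A.submatrix Fin.castSucc Fin.castSucc with hBA
  have hB : B.IsHermitian := hA.submatrix _
  let f : (Fin n → ℝ) →ₗ[ℝ] (Fin (n + 1) → ℝ) :=
    Function.ExtendByZero.linearMap ℝ Fin.castSucc
  have hcs (x : Fin n → ℝ) (i : Fin n) : f x i.castSucc = x i :=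
    (Fin.castSucc_injective n).extend_apply _ _ _
  have hlast (x : Fin n → ℝ) : f x (Fin.last n) = 0 :=
    Function.extend_apply' _ _ _ (by rintro ⟨i, hi⟩; exact i.castSucc_ne_last hi)
  have hf : Function.Injective f := fun x y hxy => by
    ext i
    rw [← hcs x, hxy, hcs]
  have hcomp : A.toQuadraticForm'.comp f = B.toQuadraticForm' := by
    ext x
    simp [Matrix.toQuadraticForm', Matrix.toLinearMap₂'_apply', dotProduct, mulVec,
      Fin.sum_univ_castSucc, hcs, hlast, hBA]
  have hcompneg : (-A.toQuadraticForm').comp f = -B.toQuadraticForm' := by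
    rw [← hcomp]; rfl
  have hp := QuadraticMap.sigPos_comp_le A.toQuadraticForm' f hf
  have hp' := QuadraticMap.sigPos_add_finrank_le A.toQuadraticForm' f hf
  have hn := QuadraticMap.sigPos_comp_le (-A.toQuadraticForm') f hf
  have hn' := QuadraticMap.sigPos_add_finrank_le (-A.toQuadraticForm') f hf
  rw [hcomp] at hp hp'
  rw [hcompneg, sigPos_neg, sigPos_neg] at hn hn'
  simp only [Module.finrank_fin_fun] at hp' hn'
  have hA0 := hA.sigPos_add_sigNeg_of_det_ne_zero
  have hA1 := hA.sigPos_add_sigNeg_lt_of_det_eq_zero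
  have hA2 := hA.sign_det
  have hB0 := hB.sigPos_add_sigNeg_of_det_ne_zero
  have hB1 := hB.sigPos_add_sigNeg_lt_of_det_eq_zero
  have hB2 := hB.sign_det
  rw [hA.signature_eq, hB.signature_eq]
  simp only [Fintype.card_fin] at hA0 hA1 hB0 hB1
  push_cast
  generalize sigPos A.toQuadraticForm' = p, sigNeg A.toQuadraticForm' = q,
    sigPos B.toQuadraticForm' = p', sigNeg B.toQuadraticForm' = q' at *
  by_cases hdA : A.det = 0
  · have hdB : B.det ≠ 0 := h.resolve_left (not_not.mpr hdA)
    have := hA1 hdA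
    have := hB0 hdB
    obtain rfl : p = p' := by omega
    obtain rfl : q = q' := by omega
    simp [hdA]
  · have h1 := hA0 hdA
    by_cases hdB : B.det = 0
    · have := hB1 hdB
      obtain rfl : p = p' + 1 := by omega
      obtain rfl : q = q' + 1 := by omega
      simp [hdB]
    · have h2 := hB0 hdB
      rw [hA2 hdA, hB2 hdB]
      have h3 : ((-1) ^ q' * (-1) ^ q' : ℝ) = 1 := by rw [← mul_pow]; simp
      obtain ⟨rfl, rfl⟩ | ⟨rfl, rfl⟩ : (p = p' + 1 ∧ q = q') ∨ (p = p' ∧ q = q' + 1) := by omega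
      · rw [h3]; push_cast; ring
      · rw [pow_succ, mul_right_comm, h3]; push_cast; ring

/-- Three-term recurrence for the determinant of a tridiagonal matrix. -/
theorem Matrix.det_tridiag {n : ℕ} (c : Fin (n + 2) → ℝ) :
    (tridiag c).det = c 0 * (tridiag fun i => c i.succ).det
      - (tridiag fun i => c i.succ.succ).det := by
  have h0 : (tridiag c).submatrix Fin.succ (Fin.succAbove 0) = tridiag fun i => c i.succ := by
    ext i j; simp [tridiag]
  have h1 : ((tridiag c).submatrix Fin.succ (Fin.succAbove 1)).det
      = (tridiag fun i => c i.succ.succ).det := by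
    rw [det_succ_column_zero, Fin.sum_univ_succ, Finset.sum_eq_zero]
    · have : ((tridiag c).submatrix Fin.succ (Fin.succAbove 1)).submatrix (Fin.succAbove 0) Fin.succ
          = tridiag fun i => c i.succ.succ := by
        ext i j; simp [tridiag]
      rw [this]
      simp [tridiag]
    · intro i _
      simp [tridiag, Fin.ext_iff]
  rw [det_succ_row_zero, Fin.sum_univ_succ, Fin.sum_univ_succ, Finset.sum_eq_zero]
  · rw [h0, Fin.succ_zero_eq_one, h1]
    simp [tridiag]
    ring
  · intro i _
    simp [tridiag, Fin.ext_iff]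

lemma Matrix.isHermitian_tridiag {n : ℕ} (c : Fin n → ℝ) : (tridiag c).IsHermitian := by
  ext i j
  by_cases h : i = j
  · simp [tridiag, h]
  · simp [tridiag, h, Ne.symm h, or_comm]

/-- The lower left entry of the associated matrix is the determinant of the tridiagonal matrix. -/
lemma assocMat_apply_one_zero : ∀ {n : ℕ} (c : Fin n → ℝ), assocMat c 1 0 = (tridiag c).det
  | 0, c => by simp [assocMat]
  | 1, c => by simp [assocMat, tridiag]
  | n + 2, c => by
    have h1 := assocMat_apply_one_zero fun i => c i.succ
    have h2 := assocMat_apply_one_zero fun i => c i.succ.succ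
    rw [Matrix.det_tridiag, ← h1, ← h2]
    simp [assocMat, List.ofFn_succ, Matrix.mul_apply, Fin.sum_univ_two, Matrix.vecMul, dotProduct,
      sub_eq_add_neg]

lemma assocMat_succ {n : ℕ} (c : Fin (n + 1) → ℝ) :
    assocMat c = assocMat (fun i : Fin n => c i.castSucc) * !![c (Fin.last n), -1; 1, 0] := by
  rw [assocMat, assocMat, List.ofFn_succ_last, List.prod_append, List.prod_singleton,
    Matrix.mul_assoc]

lemma assocMat_apply_one_one {n : ℕ} (c : Fin (n + 1) → ℝ) :
    assocMat c 1 1 = -(tridiag fun i : Fin n => c i.castSucc).det := by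
  rw [← assocMat_apply_one_zero, assocMat_succ]
  simp [Matrix.mul_apply, Fin.sum_univ_two]

lemma det_assocMat {n : ℕ} (c : Fin n → ℝ) : (assocMat c).det = 1 := by
  induction n with
  | zero => simp [assocMat]
  | succ n ih => simp [assocMat_succ, ih]

/-- Recursive formula for the signature of a tridiagonal matrix, removing the
last diagonal entry: `ζ(Λ(c_1,...,c_l)) = ζ(Λ(c_1,...,c_{l-1})) - sgn(γ) sgn(δ)`,
where `[[α,β],[γ,δ]]` is the `2 × 2` matrix associated to `(c_1,...,c_l)`. -/
theorem signature_tridiag_drop_last {l : ℕ} (hl : 2 ≤ l) (c : Fin l → ℝ) :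
    (signature (tridiag c) : ℝ) =
      (signature (tridiag fun i : Fin (l - 1) => c (Fin.castLE (by omega) i)) : ℝ)
        - Real.sign (assocMat c 1 0) * Real.sign (assocMat c 1 1) := by
  obtain ⟨n, rfl⟩ : ∃ n, l = n + 1 := ⟨l - 1, by omega⟩
  change (signature (tridiag c) : ℝ) = signature (tridiag fun i : Fin n => c i.castSucc) - _
  have hsub : (tridiag c).submatrix Fin.castSucc Fin.castSucc
      = tridiag fun i : Fin n => c i.castSucc := by
    ext i j
    simp [tridiag]
  have hdet := det_assocMat c
  rw [Matrix.det_fin_two, assocMat_apply_one_zero, assocMat_apply_one_one] at hdet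
  rw [assocMat_apply_one_zero, assocMat_apply_one_one, Real.sign_neg, mul_neg, sub_neg_eq_add,
    ← hsub]
  refine (Matrix.isHermitian_tridiag c).signature_eq_signature_submatrix_castSucc ?_
  rw [hsub]
  by_contra! h
  simp [h.1, h.2] at hdet
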